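/- Let ξ be a countable ordinal with ξ ≥ 3 and P ⊆ 2^ω a coanalytic set. Then there exists M ∈ Π^0_ξ(2^ω × 2^ω) such that P = {α ∈ 2^ω : M_α ∈ Σ^0_ξ(2^ω)}, and there exists A ∈ Σ^0_ξ(2^ω × 2^ω) such that P = {α ∈ 2^ω : A_α ∈ Π^0_ξ(2^ω)}. (Here M_α := {β : (α,β) ∈ M}.) -/

import Mathlib

open Topology MeasureTheory TopologicalSpace

abbrev Cantor : Type := ℕ → Fin 2

/-- The concatenation of the first `m` words of the sequence `a`. -/
def concatPrefix {β : Type*} (a : ℕ → List β) (m : ℕ) : List β :=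
  ((List.range m).map a).flatten

/-- The ω-power of a set `A` of finite words: the set of all infinite words obtained by
concatenating a sequence of words of `A` (infinitely many of them being nonempty). -/
def omegaPower {β : Type*} (A : Set (List β)) : Set (ℕ → β) :=
  {α | ∃ a : ℕ → List β, (∀ i, a i ∈ A) ∧
    (∀ n, ∃ m, n ≤ (concatPrefix a m).length) ∧
    ∀ (m k : ℕ) (h : k < (concatPrefix a m).length), (concatPrefix a m).get ⟨k, h⟩ = α k}

/-- The Borel class Σ⁰_ξ of a topological space: Σ⁰_ξ is the class of open sets for ξ ≤ 1,
and for ξ ≥ 2 it consists of the countable unions of sets each lying in some Π⁰_η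
with 1 ≤ η < ξ. -/
noncomputable def SigmaZero (X : Type*) [TopologicalSpace X] (ξ : Ordinal.{0}) : Set (Set X) :=
  if ξ ≤ 1 then {s | IsOpen s}
  else {s | ∃ f : ℕ → Set X,
    (∀ n, ∃ η : Ordinal.{0}, ∃ _ : 1 ≤ η, ∃ _ : η < ξ, (f n)ᶜ ∈ SigmaZero X η) ∧
    s = ⋃ n, f n}
termination_by ξ

/-- The Borel class Π⁰_ξ: complements of Σ⁰_ξ sets. -/
noncomputable def PiZero (X : Type*) [TopologicalSpace X] (ξ : Ordinal.{0}) : Set (Set X) :=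
  {s | sᶜ ∈ SigmaZero X ξ}

/-- A topological space is zero-dimensional if it has a basis consisting of clopen sets. -/
def ZeroDim (X : Type*) [TopologicalSpace X] : Prop :=
  ∃ b : Set (Set X), IsTopologicalBasis b ∧ ∀ s ∈ b, IsClopen s

/-- A set is coanalytic (Π¹₁) if its complement is analytic. -/
def Coanalytic {X : Type*} [TopologicalSpace X] (P : Set X) : Prop :=
  MeasureTheory.AnalyticSet Pᶜ

/-- A set is Σ¹₂ if it is the projection of a coanalytic subset of `X × ω^ω`. -/
def Sigma12 {X : Type*} [TopologicalSpace X] (P : Set X) : Prop :=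
  ∃ Q : Set (X × (ℕ → ℕ)), Coanalytic Q ∧ P = Prod.fst '' Q

/-- A set is Π¹₂ if its complement is Σ¹₂. -/
def Pi12 {X : Type*} [TopologicalSpace X] (P : Set X) : Prop :=
  Sigma12 Pᶜ

namespace BorelHierarchy

section Classes

variable {X Y : Type*} [TopologicalSpace X] [TopologicalSpace Y]

lemma mem_sigmaZero_of_le_one {ξ : Ordinal.{0}} (h : ξ ≤ 1) {s : Set X} :
    s ∈ SigmaZero X ξ ↔ IsOpen s := by
  rw [SigmaZero, if_pos h]; rfl

lemma mem_sigmaZero_of_one_lt {ξ : Ordinal.{0}} (h : 1 < ξ) {s : Set X} :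
    s ∈ SigmaZero X ξ ↔ ∃ f : ℕ → Set X,
      (∀ n, ∃ η : Ordinal.{0}, 1 ≤ η ∧ η < ξ ∧ (f n)ᶜ ∈ SigmaZero X η) ∧ s = ⋃ n, f n := by
  rw [SigmaZero, if_neg h.not_ge]
  simp only [exists_prop, Set.mem_ofPred_eq]

lemma preimage_mem_sigmaZero {g : X → Y} (hg : Continuous g) (ξ : Ordinal.{0}) {s : Set Y}
    (hs : s ∈ SigmaZero Y ξ) : g ⁻¹' s ∈ SigmaZero X ξ := by
  induction ξ using WellFoundedLT.induction generalizing s with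
  | ind ξ ih =>
    rcases le_or_gt ξ 1 with h | h
    · rw [mem_sigmaZero_of_le_one h] at hs ⊢
      exact hs.preimage hg
    · rw [mem_sigmaZero_of_one_lt h] at hs ⊢
      obtain ⟨f, hf, rfl⟩ := hs
      refine ⟨fun n => g ⁻¹' f n, fun n => ?_, Set.preimage_iUnion⟩
      obtain ⟨η, h1, h2, h3⟩ := hf n
      exact ⟨η, h1, h2, ih η h2 h3⟩

lemma preimage_mem_piZero {g : X → Y} (hg : Continuous g) {ξ : Ordinal.{0}} {s : Set Y}
    (hs : s ∈ PiZero Y ξ) : g ⁻¹' s ∈ PiZero X ξ :=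
  preimage_mem_sigmaZero hg ξ hs

lemma union_mem_sigmaZero {ξ : Ordinal.{0}} {s t : Set X} (hs : s ∈ SigmaZero X ξ)
    (ht : t ∈ SigmaZero X ξ) : s ∪ t ∈ SigmaZero X ξ := by
  rcases le_or_gt ξ 1 with h | h
  · rw [mem_sigmaZero_of_le_one h] at hs ht ⊢
    exact hs.union ht
  · rw [mem_sigmaZero_of_one_lt h] at hs ht ⊢
    obtain ⟨f, hf, rfl⟩ := hs
    obtain ⟨g, hg, rfl⟩ := ht
    refine ⟨fun n => Sum.elim f g (Equiv.natSumNatEquivNat.symm n), fun n => ?_, ?_⟩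
    · dsimp only
      rcases Equiv.natSumNatEquivNat.symm n with k | k
      exacts [hf k, hg k]
    · rw [Equiv.natSumNatEquivNat.symm.surjective.iUnion_comp (Sum.elim f g), Set.iUnion_sum]
      rfl

lemma inter_mem_piZero {ξ : Ordinal.{0}} {s t : Set X} (hs : s ∈ PiZero X ξ)
    (ht : t ∈ PiZero X ξ) : s ∩ t ∈ PiZero X ξ := by
  simpa only [PiZero, Set.mem_ofPred_eq, Set.compl_inter] using union_mem_sigmaZero hs ht

lemma isGδ_mem_piZero {ξ : Ordinal.{0}} (hξ : 1 < ξ) {s : Set X} (hs : IsGδ s) :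
    s ∈ PiZero X ξ := by
  obtain ⟨f, hf, rfl⟩ := isGδ_iff_eq_iInter_nat.1 hs
  refine (mem_sigmaZero_of_one_lt hξ).2 ⟨fun n => (f n)ᶜ, fun n => ⟨1, le_rfl, hξ, ?_⟩, by simp⟩
  rw [compl_compl]
  exact (mem_sigmaZero_of_le_one le_rfl).2 (hf n)

lemma univ_mem_sigmaZero (ξ : Ordinal.{0}) : (Set.univ : Set X) ∈ SigmaZero X ξ := by
  rcases le_or_gt ξ 1 with h | h
  · exact (mem_sigmaZero_of_le_one h).2 isOpen_univ
  · refine (mem_sigmaZero_of_one_lt h).2 ⟨fun _ => Set.univ, fun _ => ⟨1, le_rfl, h, ?_⟩,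
      (Set.iUnion_const _).symm⟩
    exact (mem_sigmaZero_of_le_one le_rfl).2 (by simp)

end Classes

/-- The `k`-th row of a point of the Cantor space, viewed as a double sequence. -/
def row (k : ℕ) (α : Cantor) : Cantor := fun m => α (Nat.pair k m)

/-- The point of the Cantor space with prescribed rows. -/
def ofRows (r : ℕ → Cantor) : Cantor := fun j => r j.unpair.1 j.unpair.2

@[simp] lemma row_ofRows (r : ℕ → Cantor) (k : ℕ) : row k (ofRows r) = r k := by
  funext m
  simp [row, ofRows]

lemma continuous_row (k : ℕ) : Continuous (row k) :=
  continuous_pi fun _ => continuous_apply _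

lemma continuous_ofRows : Continuous ofRows :=
  continuous_pi fun _ => (continuous_apply _).comp (continuous_apply _)

lemma isOpen_apply_eq_one (n : ℕ) : IsOpen {α : Cantor | α n = 1} :=
  (isOpen_discrete {(1 : Fin 2)}).preimage (continuous_apply (A := fun _ => Fin 2) n)

lemma exists_universal_isOpen :
    ∃ U : Set (Cantor × Cantor), IsOpen U ∧
      ∀ s : Set Cantor, IsOpen s → ∃ α, s = {β | (α, β) ∈ U} := by
  classical
  obtain ⟨b, hbc, -, hb⟩ := exists_countable_basis Cantor
  have hne : b.Nonempty := by
    obtain ⟨t, ht, -⟩ := hb.exists_subset_of_mem_open (Set.mem_univ (0 : Cantor)) isOpen_univ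
    exact ⟨t, ht⟩
  obtain ⟨B, rfl⟩ := hbc.exists_eq_range hne
  refine ⟨⋃ n, {p | p.1 n = 1} ∩ {p | p.2 ∈ B n}, ?_, fun s hs => ?_⟩
  · refine isOpen_iUnion fun n => IsOpen.inter ?_ ?_
    · exact (isOpen_apply_eq_one n).preimage continuous_fst
    · exact (hb.isOpen ⟨n, rfl⟩).preimage continuous_snd
  · refine ⟨fun n => if B n ⊆ s then 1 else 0, ?_⟩
    ext β
    simp only [Set.mem_ofPred_eq, Set.mem_iUnion, Set.mem_inter_iff, ite_eq_left_iff, zero_ne_one,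
      imp_false, not_not]
    constructor
    · intro hβ
      obtain ⟨_, ⟨n, rfl⟩, h1, h2⟩ := hb.exists_subset_of_mem_open hβ hs
      exact ⟨n, h2, h1⟩
    · rintro ⟨n, h1, h2⟩
      exact h1 h2

/-- For every countable `ξ`, the class `Σ⁰_ξ` of the Cantor space has a universal set. -/
lemma exists_universal_sigmaZero (ξ : Ordinal.{0}) (hξ : (Set.Iio ξ).Countable) :
    ∃ U ∈ SigmaZero (Cantor × Cantor) ξ,
      ∀ s ∈ SigmaZero Cantor ξ, ∃ α, s = {β | (α, β) ∈ U} := by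
  classical
  induction ξ using WellFoundedLT.induction with
  | ind ξ ih =>
    rcases le_or_gt ξ 1 with h | h
    · simpa only [mem_sigmaZero_of_le_one h] using exists_universal_isOpen
    obtain ⟨e, he⟩ := (hξ.mono Set.Ico_subset_Iio_self : (Set.Ico 1 ξ).Countable).exists_eq_range
      ⟨1, le_rfl, h⟩
    have he' (n : ℕ) : 1 ≤ e n ∧ e n < ξ := by
      have : e n ∈ Set.Ico 1 ξ := he ▸ Set.mem_range_self n
      exact this
    choose U hU hUs using fun n => ih (e n) (he' n).2 (hξ.mono (Set.Iio_subset_Iio (he' n).2.le))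
    refine ⟨⋃ k : ℕ, (fun p : Cantor × Cantor => (row k p.1, p.2)) ⁻¹' (U k.unpair.1)ᶜ, ?_, ?_⟩
    · refine (mem_sigmaZero_of_one_lt h).2 ⟨_, fun k => ⟨e k.unpair.1, (he' _).1, (he' _).2, ?_⟩, rfl⟩
      rw [← Set.preimage_compl, compl_compl]
      exact preimage_mem_sigmaZero (((continuous_row k).comp continuous_fst).prodMk continuous_snd) _
        (hU _)
    · intro s hs
      obtain ⟨f, hf, rfl⟩ := (mem_sigmaZero_of_one_lt h).1 hs
      have key (k : ℕ) : ∃ α, {β | (α, β) ∈ U k.unpair.1} =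
          if (f k.unpair.2)ᶜ ∈ SigmaZero Cantor (e k.unpair.1) then (f k.unpair.2)ᶜ
            else Set.univ := by
        split_ifs with hk
        · obtain ⟨α, hα⟩ := hUs _ _ hk
          exact ⟨α, hα.symm⟩
        · obtain ⟨α, hα⟩ := hUs k.unpair.1 _ (univ_mem_sigmaZero _)
          exact ⟨α, hα.symm⟩
      choose r hr using key
      refine ⟨ofRows r, ?_⟩
      ext β
      have hr' (k : ℕ) : (r k, β) ∈ U k.unpair.1 ↔ β ∈ {β | (r k, β) ∈ U k.unpair.1} := Iff.rfl
      simp only [Set.mem_iUnion, Set.mem_ofPred_eq, Set.mem_preimage, row_ofRows, Set.mem_compl_iff,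
        hr', hr]
      constructor
      · rintro ⟨n, hn⟩
        obtain ⟨η, h1, h2, h3⟩ := hf n
        obtain ⟨i, rfl⟩ : η ∈ Set.range e := he ▸ ⟨h1, h2⟩
        exact ⟨Nat.pair i n, by simpa [h3] using hn⟩
      · rintro ⟨k, hk⟩
        split_ifs at hk with h1
        · exact ⟨_, not_not.1 hk⟩
        · exact absurd (Set.mem_univ β) hk

lemma exists_mem_piZero_notMem_sigmaZero (ξ : Ordinal.{0}) (hξ : (Set.Iio ξ).Countable) :
    ∃ C ∈ PiZero Cantor ξ, C ∉ SigmaZero Cantor ξ := by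
  obtain ⟨U, hU, hUs⟩ := exists_universal_sigmaZero ξ hξ
  refine ⟨{α | (α, α) ∉ U}, ?_, fun hC => ?_⟩
  · have := preimage_mem_piZero (ξ := ξ) (s := Uᶜ) (continuous_id.prodMk continuous_id)
      (by simpa [PiZero] using hU)
    exact this
  · obtain ⟨α, hα⟩ := hUs _ hC
    have : (α, α) ∉ U ↔ (α, α) ∈ U := Set.ext_iff.1 hα α
    tauto

/-- Every analytic subset of the Cantor space is the projection of a `Gδ` subset of its square. -/
lemma exists_isGδ_eq_image_fst {S : Set Cantor} (hS : AnalyticSet S) :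
    ∃ G : Set (Cantor × Cantor), IsGδ G ∧ S = Prod.fst '' G := by
  classical
  rw [AnalyticSet] at hS
  rcases hS with rfl | ⟨f, hf, rfl⟩
  · exact ⟨∅, .empty, by simp⟩
  let D : Set Cantor := ⋂ n, ⋃ m, {z | z (Nat.pair n m) = 1}
  have hD : IsGδ D := .iInter_of_isOpen fun n => isOpen_iUnion fun m => isOpen_apply_eq_one _
  have hex (z : D) (n : ℕ) : ∃ m, z.1 (Nat.pair n m) = 1 := by
    simpa using Set.mem_iInter.1 z.2 n
  let g : D → ℕ → ℕ := fun z n => Nat.find (hex z n)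
  have hg : Continuous g := by
    refine continuous_pi fun n => continuous_discrete_rng.2 fun m => ?_
    have heq : (fun z => g z n) ⁻¹' {m} = Subtype.val ⁻¹' ({z : Cantor | z (Nat.pair n m) = 1} ∩
        ⋂ k ∈ Set.Iio m, {z : Cantor | z (Nat.pair n k) = 1}ᶜ) := by
      ext z
      simp [g, Nat.find_eq_iff]
    rw [heq]
    refine IsOpen.preimage continuous_subtype_val ((isOpen_apply_eq_one _).inter
      ((Set.finite_Iio m).isOpen_biInter fun k _ => IsClosed.isOpen_compl (self := ?_)))
    exact (isClosed_discrete {(1 : Fin 2)}).preimage (continuous_apply (A := fun _ => Fin 2) _)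
  have hH : IsClosed {p : Cantor × D | f (g p.2) = p.1} :=
    isClosed_eq (hf.comp (hg.comp continuous_snd)) continuous_fst
  obtain ⟨t, ht, hteq⟩ :=
    (IsInducing.id.prodMap IsInducing.subtypeVal).isClosed_iff.1 hH
  have hmem (α : Cantor) (z : D) : (α, z.1) ∈ t ↔ f (g z) = α := Set.ext_iff.1 hteq (α, z)
  refine ⟨t ∩ Prod.snd ⁻¹' D, ht.isGδ.inter (hD.preimage continuous_snd), ?_⟩
  ext α
  constructor
  · rintro ⟨x, rfl⟩
    let z : Cantor := fun j => if x j.unpair.1 = j.unpair.2 then 1 else 0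
    have hz : z ∈ D := Set.mem_iInter.2 fun n => Set.mem_iUnion.2 ⟨x n, by simp [z]⟩
    have hgz : g ⟨z, hz⟩ = x := by
      funext n
      simp only [g, Nat.find_eq_iff]
      exact ⟨by simp [z], fun k hk => by simp [z, hk.ne']⟩
    exact ⟨(f x, z), ⟨(hmem _ ⟨z, hz⟩).2 (by rw [hgz]), hz⟩, rfl⟩
  · rintro ⟨⟨α, z⟩, ⟨h1, h2⟩, rfl⟩
    exact ⟨_, (hmem α ⟨z, h2⟩).1 h1⟩

end BorelHierarchy

theorem coanalytic_as_sections_class (ξ : Ordinal.{0}) (hξ : 3 ≤ ξ)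
    (hcount : ξ.card ≤ Cardinal.aleph0)
    (P : Set Cantor) (hP : Coanalytic P) :
    (∃ M ∈ PiZero (Cantor × Cantor) ξ,
      P = {α : Cantor | {β | (α, β) ∈ M} ∈ SigmaZero Cantor ξ}) ∧
    (∃ A ∈ SigmaZero (Cantor × Cantor) ξ,
      P = {α : Cantor | {β | (α, β) ∈ A} ∈ PiZero Cantor ξ}) := by
  open BorelHierarchy in
  have h1 : 1 < ξ := lt_of_lt_of_le (by norm_num) hξ
  have hIio : (Set.Iio ξ).Countable := by
    rw [← Cardinal.le_aleph0_iff_set_countable, Cardinal.mk_Iio_ordinal]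
    rwa [← Cardinal.lift_aleph0.{1, 0}, Cardinal.lift_le]
  obtain ⟨C, hC, hC'⟩ := exists_mem_piZero_notMem_sigmaZero ξ hIio
  obtain ⟨G, hG, hPG⟩ := exists_isGδ_eq_image_fst hP
  suffices ∃ M ∈ PiZero (Cantor × Cantor) ξ,
      P = {α : Cantor | {β | (α, β) ∈ M} ∈ SigmaZero Cantor ξ} by
    obtain ⟨M, hM, hPM⟩ := this
    refine ⟨⟨M, hM, hPM⟩, Mᶜ, hM, hPM.trans ?_⟩
    ext α
    simp [PiZero, Set.compl_ofPred]
  refine ⟨(fun p => (p.1, row 0 p.2)) ⁻¹' G ∩ (fun p => row 1 p.2) ⁻¹' C,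
    inter_mem_piZero (preimage_mem_piZero ?_ (isGδ_mem_piZero h1 hG))
      (preimage_mem_piZero ?_ hC), ?_⟩
  · exact continuous_fst.prodMk ((continuous_row 0).comp continuous_snd)
  · exact (continuous_row 1).comp continuous_snd
  ext α
  constructor
  · intro hα
    have hempty (γ : Cantor) : (α, γ) ∉ G := fun hγ =>
      (hPG ▸ Set.mem_image_of_mem Prod.fst hγ : α ∈ Pᶜ) hα
    have := isGδ_mem_piZero h1 (IsGδ.univ (X := Cantor))
    simpa [hempty, PiZero] using this
  · intro hα
    by_contra hαP
    obtain ⟨⟨_, γ⟩, hγ, rfl⟩ : α ∈ Prod.fst '' G := hPG ▸ hαP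
    refine hC' ?_
    have hcont : Continuous fun δ : Cantor => ofRows fun k => if k = 0 then γ else δ :=
      continuous_ofRows.comp (continuous_pi fun k => by split_ifs <;> fun_prop)
    simpa [hγ] using preimage_mem_sigmaZero hcont ξ hα
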